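/- Let P ⊂ ℝⁿ be a bounded open convex polytope containing the origin, presented as P = {x : ⟨l_i, x⟩ < λ_i, i = 1,…,d}, satisfying the Delzant condition. Then for every K > 0 and every u ∈ 𝒞⋆^K(P) with Alexandrov Hessian H, the function x ↦ log⁺(det H(x)) is integrable on P, i.e. ∫_P log⁺(det H(x)) dx < ∞. -/

import Mathlib

open MeasureTheory Filter Set Metric
open scoped ENNReal RealInnerProductSpace Topology NNReal

noncomputable section

namespace ToricExtremal

/-- The open polytope `{x | ⟨l i, x⟩ < λ i for all i}` determined by a half-space
presentation with normals `l` and constants `lam`. -/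
def Poly {n : ℕ} {ι : Type*} [Fintype ι] (l : ι → EuclideanSpace ℝ (Fin n))
    (lam : ι → ℝ) : Set (EuclideanSpace ℝ (Fin n)) :=
  {x | ∀ i, ⟪l i, x⟫ < lam i}

/-- The inner polytope `P_δ`, whose facets are parallel to those of `P` at distance `δ`. -/
def PolyInner {n : ℕ} {ι : Type*} [Fintype ι] (l : ι → EuclideanSpace ℝ (Fin n))
    (lam : ι → ℝ) (δ : ℝ) : Set (EuclideanSpace ℝ (Fin n)) :=
  {x | ∀ i, ⟪l i, x⟫ < lam i - ‖l i‖ * δ}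

/-- The facet `F i = {x ∈ ∂P | ⟨l i, x⟩ = λ i}`. -/
def Facet {n : ℕ} {ι : Type*} [Fintype ι] (l : ι → EuclideanSpace ℝ (Fin n))
    (lam : ι → ℝ) (i : ι) : Set (EuclideanSpace ℝ (Fin n)) :=
  {x ∈ frontier (Poly l lam) | ⟪l i, x⟫ = lam i}

/-- `σ₀`: the `(n-1)`-dimensional Hausdorff measure on `ℝⁿ`. -/
def sigma0 (n : ℕ) : Measure (EuclideanSpace ℝ (Fin n)) := μH[(n : ℝ) - 1]

/-- The weighted boundary measure `σ`, equal to `|l i|⁻¹ σ₀` on the facet `F i`. -/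
def sigmaW {n : ℕ} {ι : Type*} [Fintype ι] (l : ι → EuclideanSpace ℝ (Fin n))
    (lam : ι → ℝ) : Measure (EuclideanSpace ℝ (Fin n)) :=
  ∑ i : ι, (ENNReal.ofReal (1 / ‖l i‖)) • ((sigma0 n).restrict (Facet l lam i))

/-- The Delzant condition: every normal `l i` is a primitive integral vector, and every
vertex (extreme point of the closure) lies on exactly `n` facets whose normals form a
`ℤ`-basis of `ℤⁿ` (equivalently, an integral matrix of determinant `±1`). -/
def IsDelzant {n : ℕ} {ι : Type*} [Fintype ι] (l : ι → EuclideanSpace ℝ (Fin n))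
    (lam : ι → ℝ) : Prop :=
  (∀ i j, ∃ m : ℤ, l i j = (m : ℝ)) ∧
  (∀ i, ∀ k : ℕ, 2 ≤ k → ¬ (∀ j, ∃ m : ℤ, l i j = (k : ℝ) * (m : ℝ))) ∧
  (∀ x ∈ Set.extremePoints ℝ (closure (Poly l lam)),
    ∃ e : Fin n ≃ {i : ι // ⟪l i, x⟫ = lam i},
      |(Matrix.of fun j k => l (e j).1 k).det| = 1)

/-- The second partial derivative `∂²u/∂xᵢ∂xⱼ` at `x`. -/
def secondPartial {n : ℕ} (u : EuclideanSpace ℝ (Fin n) → ℝ) (i j : Fin n)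
    (x : EuclideanSpace ℝ (Fin n)) : ℝ :=
  iteratedFDeriv ℝ 2 u x ![EuclideanSpace.single i 1, EuclideanSpace.single j 1]

/-- The (classical) Hessian matrix `D²u(x)`. -/
def hessianMatrix {n : ℕ} (u : EuclideanSpace ℝ (Fin n) → ℝ)
    (x : EuclideanSpace ℝ (Fin n)) : Matrix (Fin n) (Fin n) ℝ :=
  Matrix.of fun i j => secondPartial u i j x

/-- Guillemin's canonical potential `u_P(x) = Σᵢ (λᵢ − ⟨lᵢ,x⟩) log (λᵢ − ⟨lᵢ,x⟩)`. -/
def guillemin {n : ℕ} {ι : Type*} [Fintype ι] (l : ι → EuclideanSpace ℝ (Fin n))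
    (lam : ι → ℝ) (x : EuclideanSpace ℝ (Fin n)) : ℝ :=
  ∑ i : ι, (lam i - ⟪l i, x⟫) * Real.log (lam i - ⟪l i, x⟫)

/-- `(u_P)^{ij}_{ij}`: the double divergence `Σ_{i,j} ∂²((D²u_P)⁻¹)_{ij}/∂xᵢ∂xⱼ` of the
inverse Hessian of the Guillemin potential. -/
def divDivInvHessGuillemin {n : ℕ} {ι : Type*} [Fintype ι]
    (l : ι → EuclideanSpace ℝ (Fin n)) (lam : ι → ℝ) (x : EuclideanSpace ℝ (Fin n)) : ℝ :=
  ∑ i : Fin n, ∑ j : Fin n,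
    secondPartial (fun y => (hessianMatrix (guillemin l lam) y)⁻¹ i j) i j x

/-- `H` is an Alexandrov Hessian of `u` on `P`: a measurable matrix-valued map which is
a.e. positive semidefinite and gives the second-order Taylor expansion of `u` at a.e.
point of `P`. -/
def IsAlexHessian {n : ℕ} (P : Set (EuclideanSpace ℝ (Fin n)))
    (u : EuclideanSpace ℝ (Fin n) → ℝ)
    (H : EuclideanSpace ℝ (Fin n) → Matrix (Fin n) (Fin n) ℝ) : Prop :=
  (∀ i j, Measurable fun x => H x i j) ∧
  ∀ᵐ x ∂(volume.restrict P),
    (H x).PosSemidef ∧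
    ∃ g : EuclideanSpace ℝ (Fin n),
      Tendsto (fun y : EuclideanSpace ℝ (Fin n) =>
          (u y - u x - ⟪g, y - x⟫
            - (1 / 2) * ∑ i : Fin n, ∑ j : Fin n, H x i j * (y - x) i * (y - x) j)
          / ‖y - x‖ ^ 2)
        (𝓝[≠] x) (𝓝 0)

/-- The radial boundary extension `u(z) = lim_{t→1⁻} u (t • z)` (as a value in `[0,∞]`,
computed via `limsup` so as to be everywhere defined). -/
def radExt {n : ℕ} (u : EuclideanSpace ℝ (Fin n) → ℝ) (z : EuclideanSpace ℝ (Fin n)) : ℝ≥0∞ :=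
  Filter.limsup (fun t : ℝ => ENNReal.ofReal (u (t • z))) (𝓝[<] (1 : ℝ))

/-- The radial limits of `u` exist (in `[0,∞]`) at every boundary point of `P`. -/
def HasRadExt {n : ℕ} (P : Set (EuclideanSpace ℝ (Fin n)))
    (u : EuclideanSpace ℝ (Fin n) → ℝ) : Prop :=
  ∀ z ∈ frontier P,
    Tendsto (fun t : ℝ => ENNReal.ofReal (u (t • z))) (𝓝[<] (1 : ℝ)) (𝓝 (radExt u z))

/-- The class `𝒞⋆^K(P)`: nonnegative convex functions on `P`, vanishing at the origin,
whose radial boundary extension has `σ₀`-integral at most `K`. -/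
def MemCstar {n : ℕ} {ι : Type*} [Fintype ι] (l : ι → EuclideanSpace ℝ (Fin n))
    (lam : ι → ℝ) (K : ℝ) (u : EuclideanSpace ℝ (Fin n) → ℝ) : Prop :=
  ConvexOn ℝ (Poly l lam) u ∧ u 0 = 0 ∧ (∀ x ∈ Poly l lam, 0 ≤ u x) ∧
  HasRadExt (Poly l lam) u ∧
  ∫⁻ z in frontier (Poly l lam), radExt u z ∂(sigma0 n) ≤ ENNReal.ofReal K

/-- The class `𝒞`: convex functions of the form `u = u_P + v` with `v` smooth up to the
boundary of `P`. -/
def MemC {n : ℕ} {ι : Type*} [Fintype ι] (l : ι → EuclideanSpace ℝ (Fin n))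
    (lam : ι → ℝ) (u : EuclideanSpace ℝ (Fin n) → ℝ) : Prop :=
  ConvexOn ℝ (Poly l lam) u ∧
  ∃ v : EuclideanSpace ℝ (Fin n) → ℝ, ContDiffOn ℝ (⊤ : ℕ∞) v (closure (Poly l lam)) ∧
    ∀ x ∈ closure (Poly l lam), u x = guillemin l lam x + v x

/-- The normalized class `𝒞̃ = {u ∈ 𝒞 : inf_P u = u 0 = 0}`. -/
def MemCt {n : ℕ} {ι : Type*} [Fintype ι] (l : ι → EuclideanSpace ℝ (Fin n))
    (lam : ι → ℝ) (u : EuclideanSpace ℝ (Fin n) → ℝ) : Prop :=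
  MemC l lam u ∧ u 0 = 0 ∧ ∀ x ∈ Poly l lam, 0 ≤ u x

/-- `f` is an affine function on `ℝⁿ`. -/
def IsAffineFn {n : ℕ} (f : EuclideanSpace ℝ (Fin n) → ℝ) : Prop :=
  ∃ (g : EuclideanSpace ℝ (Fin n)) (c : ℝ), ∀ x, f x = ⟪g, x⟫ + c

/-- The (signed) integral `∫_S log (det H) dx`, with values in `EReal`: it is defined as
the difference of the integrals of the positive part `log⁺` and the negative part `log⁻`. -/
def logDetE {n : ℕ} (S : Set (EuclideanSpace ℝ (Fin n)))
    (H : EuclideanSpace ℝ (Fin n) → Matrix (Fin n) (Fin n) ℝ) : EReal :=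
  ((∫⁻ x in S, ENNReal.ofReal (Real.log (H x).det) : ℝ≥0∞) : EReal)
    - ((∫⁻ x in S, ENNReal.ofReal (-Real.log (H x).det) : ℝ≥0∞) : EReal)

/-- The Donaldson functional
`ℱ(u) = −∫_P log (det H) dx + ∫_{∂P} u dσ − ∫_P f ⬝ u dx`, valued in `EReal`, where `H` is
an Alexandrov Hessian of `u` and the boundary term uses the radial extension of `u`. -/
def Fcal {n : ℕ} {ι : Type*} [Fintype ι] (l : ι → EuclideanSpace ℝ (Fin n)) (lam : ι → ℝ)
    (f : EuclideanSpace ℝ (Fin n) → ℝ) (u : EuclideanSpace ℝ (Fin n) → ℝ)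
    (H : EuclideanSpace ℝ (Fin n) → Matrix (Fin n) (Fin n) ℝ) : EReal :=
  ((∫⁻ z, radExt u z ∂(sigmaW l lam) : ℝ≥0∞) : EReal)
    - ((∫ x in Poly l lam, f x * u x : ℝ) : EReal)
    - logDetE (Poly l lam) H

/-- The half-space presentation of the open rectangle `∏ (αᵢ, βᵢ)`: normals. -/
def rectL (n : ℕ) : (Fin n ⊕ Fin n) → EuclideanSpace ℝ (Fin n) :=
  Sum.elim (fun i => EuclideanSpace.single i 1) (fun i => -EuclideanSpace.single i 1)

/-- The half-space presentation of the open rectangle `∏ (αᵢ, βᵢ)`: constants. -/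
def rectLam {n : ℕ} (α β : Fin n → ℝ) : (Fin n ⊕ Fin n) → ℝ :=
  Sum.elim β (fun i => -α i)


/-- The functional `ℱ` on smooth elements of `𝒞̃` (real-valued):
`ℱ(u) = −∫_P log det D²u + ∫_{∂P} u dσ − ∫_P f ⬝ u dx`. -/
def FcalSmooth {n : ℕ} {ι : Type*} [Fintype ι] (l : ι → EuclideanSpace ℝ (Fin n))
    (lam : ι → ℝ) (f u : EuclideanSpace ℝ (Fin n) → ℝ) : ℝ :=
  -(∫ x in Poly l lam, Real.log ((hessianMatrix u x).det))
    + ((∫ z, u z ∂(sigmaW l lam)) - ∫ x in Poly l lam, f x * u x)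

section Calculus

theorem pow_le_taylor_two (m : ℕ) {s t B : ℝ} (hs : 0 ≤ s) (ht : 0 ≤ t) (hsB : s ≤ B)
    (htB : t ≤ B) :
    s ^ (m + 2) ≤ t ^ (m + 2) + (m + 2) * t ^ (m + 1) * (s - t)
      + (m + 2) ^ 2 * B ^ m * (s - t) ^ 2 := by
  have hB : 0 ≤ B := hs.trans hsB
  induction m with
  | zero => norm_num; nlinarith [sq_nonneg (s - t)]
  | succ k ih =>
    push_cast
    set q := (s - t) ^ 2 with hq
    have hq0 : 0 ≤ q := sq_nonneg _
    have h1 : s * (s ^ (k + 2) - t ^ (k + 2) - (k + 2) * t ^ (k + 1) * (s - t))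
        ≤ B * ((k + 2) ^ 2 * B ^ k * q) :=
      calc _ ≤ s * ((k + 2) ^ 2 * B ^ k * q) := by gcongr; linarith
        _ ≤ _ := by gcongr
    have h2 : (k + 2) * t ^ (k + 1) * q ≤ (k + 2) * B ^ (k + 1) * q := by gcongr
    have h3 : s ^ (k + 1 + 2) - t ^ (k + 1 + 2) - (k + 1 + 2) * t ^ (k + 1 + 1) * (s - t)
        = s * (s ^ (k + 2) - t ^ (k + 2) - (k + 2) * t ^ (k + 1) * (s - t))
          + (k + 2) * t ^ (k + 1) * q := by rw [hq]; ring
    have h4 : (0 : ℝ) ≤ (k + 3) * B ^ (k + 1) * q := by positivity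
    have h5 : B * ((k + 2) ^ 2 * B ^ k * q) + (k + 2) * B ^ (k + 1) * q
        + (k + 3) * B ^ (k + 1) * q = (k + 1 + 2) ^ 2 * B ^ (k + 1) * q := by ring
    linarith

theorem posPart_pow_le_taylor_two (m : ℕ) {s t B : ℝ} (hsB : s ≤ B) (htB : t ≤ B) (hB : 0 ≤ B) :
    max s 0 ^ (m + 2) ≤ max t 0 ^ (m + 2) + (m + 2) * max t 0 ^ (m + 1) * (s - t)
      + (m + 2) ^ 2 * B ^ m * (s - t) ^ 2 := by
  have hm : (0 : ℝ) ≤ m := m.cast_nonneg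
  have hBm : 0 ≤ B ^ m * (s - t) ^ 2 := by positivity
  rcases le_total 0 t with ht | ht
  · rw [max_eq_left ht]
    rcases le_total 0 s with hs | hs
    · rw [max_eq_left hs]
      exact pow_le_taylor_two m hs ht hsB htB
    · rw [max_eq_right hs, zero_pow (by omega)]
      have h1 : t ^ (m + 1) * (t - s) ≤ B ^ m * (s - t) ^ 2 :=
        calc t ^ (m + 1) * (t - s) = t ^ m * (t * (t - s)) := by ring
          _ ≤ B ^ m * (s - t) ^ 2 :=
            mul_le_mul (by gcongr) (by nlinarith) (by nlinarith) (by positivity)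
      have h2 : 0 ≤ t ^ (m + 2) := by positivity
      have h3 := mul_le_mul_of_nonneg_left h1 (by linarith : (0 : ℝ) ≤ m + 2)
      have h4 : (0 : ℝ) ≤ (m + 2) * (m + 1) * (B ^ m * (s - t) ^ 2) := by positivity
      linarith
  · rw [max_eq_right ht, zero_pow (by omega), zero_pow (by omega)]
    have h1 : max s 0 ^ (m + 2) ≤ B ^ m * (s - t) ^ 2 := by
      rcases le_total 0 s with hs | hs
      · rw [max_eq_left hs, pow_add]
        gcongr; linarith
      · rw [max_eq_right hs, zero_pow (by omega)]; positivity
    have h2 : (0 : ℝ) ≤ (m + 1) * (m + 3) * (B ^ m * (s - t) ^ 2) := by positivity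
    linarith

/-- Second difference of `t ↦ (t₊) ^ (m + 2)` along a midpoint-concave triple. -/
theorem posPart_pow_second_difference_le (m : ℕ) {s s' t B η : ℝ} (hs : |s - t| ≤ η)
    (hs' : |s' - t| ≤ η) (hmid : s + s' ≤ 2 * t) (hB : t + η ≤ B) (hB0 : 0 ≤ B) :
    max s 0 ^ (m + 2) + max s' 0 ^ (m + 2) - 2 * max t 0 ^ (m + 2)
      ≤ 2 * (m + 2) ^ 2 * B ^ m * η ^ 2 := by
  have hη : 0 ≤ η := (abs_nonneg _).trans hs
  rw [abs_le] at hs hs'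
  have h1 := posPart_pow_le_taylor_two m (by linarith : s ≤ B) (by linarith : t ≤ B) hB0
  have h2 := posPart_pow_le_taylor_two m (by linarith : s' ≤ B) (by linarith : t ≤ B) hB0
  have h3 : (m + 2) ^ 2 * B ^ m * (s - t) ^ 2 ≤ (m + 2) ^ 2 * B ^ m * η ^ 2 := by
    gcongr 1; nlinarith
  have h4 : (m + 2) ^ 2 * B ^ m * (s' - t) ^ 2 ≤ (m + 2) ^ 2 * B ^ m * η ^ 2 := by
    gcongr 1; nlinarith
  have h5 : (m + 2) * max t 0 ^ (m + 1) * (s + s' - 2 * t) ≤ 0 :=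
    mul_nonpos_of_nonneg_of_nonpos (by positivity) (by linarith)
  nlinarith

end Calculus

section Gauge

variable {E : Type*} [NormedAddCommGroup E] [NormedSpace ℝ E] {P : Set E}

theorem mem_iff_gauge_lt_one (hc : Convex ℝ P) (ho : IsOpen P) (h0 : (0 : E) ∈ P) {x : E} :
    x ∈ P ↔ gauge P x < 1 := by
  rw [gauge_lt_one_iff_mem_interior hc (ho.mem_nhds h0), ho.interior_eq]

theorem gauge_add_le_gauge_add_norm_div (hc : Convex ℝ P) {r : ℝ} (hr : 0 < r)
    (hball : ball (0 : E) r ⊆ P) (x w : E) : gauge P (x + w) ≤ gauge P x + ‖w‖ / r := by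
  refine (gauge_add_le hc (absorbent_nhds_zero (mem_of_superset (ball_mem_nhds 0 hr) hball)) x w).trans ?_
  gcongr
  rw [le_div_iff₀ hr, mul_comm]
  exact mul_gauge_le_norm hball

theorem abs_gauge_add_sub_gauge_le (hc : Convex ℝ P) {r : ℝ} (hr : 0 < r)
    (hball : ball (0 : E) r ⊆ P) (x w : E) : |gauge P (x + w) - gauge P x| ≤ ‖w‖ / r := by
  have h1 := gauge_add_le_gauge_add_norm_div hc hr hball x w
  have h2 := gauge_add_le_gauge_add_norm_div hc hr hball (x + w) (-w)
  rw [norm_neg, add_neg_cancel_right] at h2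
  rw [abs_le]; constructor <;> linarith

theorem two_mul_gauge_le (hc : Convex ℝ P) (h0 : P ∈ 𝓝 (0 : E)) (x w : E) :
    2 * gauge P x ≤ gauge P (x + w) + gauge P (x - w) := by
  have h := gauge_add_le hc (absorbent_nhds_zero h0) (x + w) (x - w)
  rwa [show x + w + (x - w) = (2 : ℝ) • x by rw [two_smul]; abel,
    gauge_smul_of_nonneg (by norm_num)] at h

theorem exists_pos_add_smul_mem_frontier (hc : Convex ℝ P) (ho : IsOpen P) (h0 : (0 : E) ∈ P)
    (hb : Bornology.IsBounded P) {p e : E} (hp : p ∈ P) (he : e ≠ 0) :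
    ∃ t : ℝ, 0 < t ∧ p + t • e ∈ frontier P := by
  obtain ⟨R, hR⟩ := hb.subset_closedBall 0
  have hnhds := ho.mem_nhds h0
  have hcont : Continuous fun t : ℝ => gauge P (p + t • e) :=
    (continuous_gauge hc hnhds).comp (by fun_prop)
  have hp1 := (mem_iff_gauge_lt_one hc ho h0).1 hp
  have he' : 0 < ‖e‖ := norm_pos_iff.2 he
  have hR0 : 0 ≤ R := by simpa using hR h0
  set T : ℝ := (R + ‖p‖ + 1) / ‖e‖ with hT
  have hT0 : 0 ≤ T := by positivity
  have hout : 1 ≤ gauge P (p + T • e) := by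
    by_contra hlt
    have h1 := hR ((mem_iff_gauge_lt_one hc ho h0).2 (not_le.1 hlt))
    rw [mem_closedBall_zero_iff] at h1
    have h2 : ‖T • e‖ ≤ ‖p + T • e‖ + ‖p‖ := by
      simpa using norm_sub_le (p + T • e) p
    rw [norm_smul, Real.norm_of_nonneg hT0, hT, div_mul_cancel₀ _ he'.ne'] at h2
    linarith
  obtain ⟨t, ht, ht1⟩ := intermediate_value_Icc hT0 hcont.continuousOn
    (show (1 : ℝ) ∈ Icc _ _ from ⟨by simpa using hp1.le, hout⟩)
  refine ⟨t, lt_of_le_of_ne ht.1 ?_, (gauge_eq_one_iff_mem_frontier hc hnhds).1 ht1⟩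
  rintro rfl
  simp only [zero_smul, add_zero] at ht1
  exact hp1.ne ht1

theorem smul_mem_of_mem_frontier (hc : Convex ℝ P) (ho : IsOpen P) (h0 : (0 : E) ∈ P) {z : E}
    (hz : z ∈ frontier P) {t : ℝ} (ht0 : 0 ≤ t) (ht1 : t < 1) : t • z ∈ P := by
  rw [mem_iff_gauge_lt_one hc ho h0, gauge_smul_of_nonneg ht0,
    (gauge_eq_one_iff_mem_frontier hc (ho.mem_nhds h0)).2 hz]
  simpa using ht1

open scoped Pointwise in
theorem volume_one_sub_gauge_le [MeasurableSpace E] [BorelSpace E] [FiniteDimensional ℝ E]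
    (μ : Measure E) [μ.IsAddHaarMeasure] (hc : Convex ℝ P) (ho : IsOpen P) (h0 : (0 : E) ∈ P)
    (hb : Bornology.IsBounded P) {τ : ℝ} (hτ0 : 0 ≤ τ) (hτ : τ < 1) :
    μ (P ∩ {x | 1 - gauge P x ≤ τ})
      ≤ ENNReal.ofReal (Module.finrank ℝ E * τ) * μ P := by
  have hs : 0 < 1 - τ := by linarith
  have hgauge : ∀ y ∈ P, gauge P ((1 - τ) • y) < 1 - τ := fun y hy => by
    rw [gauge_smul_of_nonneg hs.le, smul_eq_mul]
    nlinarith [(mem_iff_gauge_lt_one hc ho h0).1 hy]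
  have hsub : (1 - τ) • P ⊆ P := by
    rintro _ ⟨y, hy, rfl⟩
    exact (mem_iff_gauge_lt_one hc ho h0).2 ((hgauge y hy).trans_le (by linarith))
  have hsub' : P ∩ {x | 1 - gauge P x ≤ τ} ⊆ P \ (1 - τ) • P := by
    rintro x ⟨hx, hxτ⟩
    refine ⟨hx, ?_⟩
    rintro ⟨y, hy, rfl⟩
    have := hgauge y hy
    simp only [mem_ofPred_eq] at hxτ
    linarith
  have hfin : μ P ≠ ⊤ := hb.measure_lt_top.ne
  refine (measure_mono hsub').trans ?_
  rw [measure_sdiff hsub (ho.smul₀ hs.ne').measurableSet.nullMeasurableSet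
    (measure_ne_top_of_subset hsub hfin), Measure.addHaar_smul, abs_of_pos (by positivity)]
  rw [tsub_le_iff_right, ← add_mul, ← ENNReal.ofReal_add (by positivity) (by positivity)]
  have hB := one_add_mul_le_pow (show (-2 : ℝ) ≤ -τ by linarith) (Module.finrank ℝ E)
  have h1 : (1 : ℝ≥0∞) ≤ ENNReal.ofReal (Module.finrank ℝ E * τ + (1 - τ) ^ Module.finrank ℝ E) := by
    rw [ENNReal.one_le_ofReal, sub_eq_add_neg]
    linarith
  calc μ P = 1 * μ P := (one_mul _).symm
    _ ≤ _ := by gcongr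

theorem lintegral_neg_log_one_sub_gauge_lt_top [MeasurableSpace E] [BorelSpace E]
    [FiniteDimensional ℝ E] (μ : Measure E) [μ.IsAddHaarMeasure] (hc : Convex ℝ P)
    (ho : IsOpen P) (h0 : (0 : E) ∈ P) (hb : Bornology.IsBounded P) :
    ∫⁻ x in P, ENNReal.ofReal (-Real.log (1 - gauge P x)) ∂μ < ⊤ := by
  have hmeas : Measurable fun x => -Real.log (1 - gauge P x) :=
    (Real.measurable_log.comp
      (measurable_const.sub (continuous_gauge hc (ho.mem_nhds h0)).measurable)).neg
  have hpos : ∀ x ∈ P, 0 < 1 - gauge P x := fun x hx => by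
    linarith [(mem_iff_gauge_lt_one hc ho h0).1 hx]
  rw [lintegral_eq_lintegral_meas_le]
  · calc ∫⁻ t in Ioi (0 : ℝ), μ.restrict P {a | t ≤ -Real.log (1 - gauge P a)}
        ≤ ∫⁻ t in Ioi (0 : ℝ), ENNReal.ofReal (Real.exp (-t)) *
            (ENNReal.ofReal (Module.finrank ℝ E) * μ P) := by
          refine setLIntegral_mono' measurableSet_Ioi fun t ht => ?_
          rw [Measure.restrict_apply (measurableSet_le measurable_const hmeas), inter_comm]
          refine (measure_mono ?_).trans ((volume_one_sub_gauge_le μ hc ho h0 hb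
            (Real.exp_pos (-t)).le (by simpa using ht)).trans_eq ?_)
          · rintro x ⟨hx, hxt⟩
            refine ⟨hx, ?_⟩
            simp only [mem_ofPred_eq] at hxt ⊢
            rw [← Real.log_le_iff_le_exp (hpos x hx)]
            linarith
          · rw [ENNReal.ofReal_mul (by positivity)]
            ring
      _ < ⊤ := by
          rw [lintegral_mul_const _ (by fun_prop)]
          refine ENNReal.mul_lt_top ?_ (ENNReal.mul_lt_top ENNReal.ofReal_lt_top hb.measure_lt_top)
          exact (integrableOn_exp_neg_Ioi 0).lintegral_lt_top
  · filter_upwards [ae_restrict_mem ho.measurableSet] with x hx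
    simp only [Pi.zero_apply, neg_nonneg]
    exact Real.log_nonpos (hpos x hx).le (by linarith [gauge_nonneg (s := P) x])
  · exact hmeas.aemeasurable

end Gauge

section BoundaryEstimate

variable {m : ℕ} {P : Set (EuclideanSpace ℝ (Fin (m + 1)))}

/-- The part of `∂P` strictly beyond a hyperplane through `x` projects onto a cube of side
comparable to the distance of `x` to `∂P`. -/
theorem le_hausdorffMeasure_frontier_inter (hc : Convex ℝ P) (ho : IsOpen P)
    (h0 : (0 : EuclideanSpace ℝ (Fin (m + 1))) ∈ P) (hb : Bornology.IsBounded P)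
    {x e : EuclideanSpace ℝ (Fin (m + 1))} (he : e ≠ 0) {δ : ℝ} (hδ : 0 < δ)
    (hball : ball x δ ⊆ P) :
    ENNReal.ofReal ((2 * (δ / (m + 1))) ^ m)
      ≤ μH[(m : ℝ)] (frontier P ∩ {z | ⟪e, x⟫ < ⟪e, z⟫}) := by
  have : Fact (Module.finrank ℝ (EuclideanSpace ℝ (Fin (m + 1))) = m + 1) := ⟨by simp⟩
  let b := OrthonormalBasis.fromOrthogonalSpanSingleton (𝕜 := ℝ) m he
  have hbe : ∀ i, ⟪e, (b i : EuclideanSpace ℝ (Fin (m + 1)))⟫ = 0 := fun i =>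
    Submodule.mem_orthogonal_singleton_iff_inner_right.1 (b i).2
  have hbn : ∀ i, ‖(b i : EuclideanSpace ℝ (Fin (m + 1)))‖ = 1 := fun i => b.orthonormal.1 i
  have hbb : ∀ i j, ⟪(b i : EuclideanSpace ℝ (Fin (m + 1))), (b j : _)⟫
      = if i = j then (1 : ℝ) else 0 := fun i j => by
    rw [← Submodule.coe_inner]
    exact orthonormal_iff_ite.1 b.orthonormal i j
  let L : EuclideanSpace ℝ (Fin (m + 1)) → (Fin m → ℝ) := fun y i =>
    ⟪(b i : EuclideanSpace ℝ (Fin (m + 1))), y⟫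
  have hL : LipschitzWith 1 L := LipschitzWith.of_dist_le_mul fun y z => by
    rw [NNReal.coe_one, one_mul, dist_pi_le_iff dist_nonneg]
    intro i
    rw [Real.dist_eq, ← inner_sub_right, dist_eq_norm]
    refine (abs_real_inner_le_norm _ _).trans ?_
    rw [hbn, one_mul]
  set ρ := δ / (m + 1) with hρ
  have hρ0 : 0 < ρ := by positivity
  have himg : ball (L x) ρ ⊆ L '' (frontier P ∩ {z | ⟪e, x⟫ < ⟪e, z⟫}) := by
    intro c hcb
    set v : EuclideanSpace ℝ (Fin (m + 1)) := ∑ j, (c j - L x j) • (b j : _) with hv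
    have hvn : ‖v‖ < δ := by
      have h1 : ∀ j, |c j - L x j| ≤ ρ := fun j =>
        ((dist_le_pi_dist c (L x) j).trans_lt hcb).le
      calc ‖v‖ ≤ ∑ j : Fin m, ρ := norm_sum_le_of_le _ fun j _ => by
            rw [norm_smul, hbn, mul_one]; exact h1 j
        _ = m * ρ := by simp
        _ < (m + 1) * ρ := by linarith
        _ = δ := by rw [hρ]; field_simp
    have hve : ⟪e, v⟫ = 0 := by
      rw [hv, inner_sum]
      exact Finset.sum_eq_zero fun j _ => by rw [inner_smul_right, hbe, mul_zero]
    have hp : x + v ∈ P := hball (by simpa using hvn)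
    obtain ⟨t, ht, hz⟩ := exists_pos_add_smul_mem_frontier hc ho h0 hb hp he
    refine ⟨x + v + t • e, ⟨hz, ?_⟩, ?_⟩
    · have : 0 < ⟪e, e⟫ := real_inner_self_pos.2 he
      simp only [mem_ofPred_eq, inner_add_right, inner_smul_right, hve]
      nlinarith
    · ext i
      have hie : ⟪(b i : EuclideanSpace ℝ (Fin (m + 1))), e⟫ = 0 := by
        rw [real_inner_comm]; exact hbe i
      simp only [L, inner_add_right, inner_smul_right, hie, hv, inner_sum, hbb]
      simp
  calc ENNReal.ofReal ((2 * ρ) ^ m) = volume (ball (L x) ρ) := by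
        rw [Real.volume_pi_ball _ hρ0, Fintype.card_fin]
    _ = μH[(m : ℝ)] (ball (L x) ρ) := by
        have := hausdorffMeasure_pi_real (ι := Fin m)
        rw [Fintype.card_fin] at this
        rw [this]
    _ ≤ μH[(m : ℝ)] (L '' (frontier P ∩ {z | ⟪e, x⟫ < ⟪e, z⟫})) := measure_mono himg
    _ ≤ _ := by simpa using hL.hausdorffMeasure_image_le m.cast_nonneg _

/-- A nonnegative convex function whose radial boundary values have bounded integral grows at
most polynomially in the inverse distance to the boundary. -/
theorem mul_one_sub_gauge_pow_le (hc : Convex ℝ P) (ho : IsOpen P)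
    (h0 : (0 : EuclideanSpace ℝ (Fin (m + 1))) ∈ P) (hb : Bornology.IsBounded P) {r : ℝ}
    (hr : 0 < r) (hball : ball (0 : EuclideanSpace ℝ (Fin (m + 1))) r ⊆ P)
    {u : EuclideanSpace ℝ (Fin (m + 1)) → ℝ} (hu : ConvexOn ℝ P u) (hu0 : u 0 = 0) {K : ℝ}
    (hK : 0 ≤ K)
    (hint : ∫⁻ z in frontier P, radExt u z ∂μH[(m : ℝ)] ≤ ENNReal.ofReal K)
    {x : EuclideanSpace ℝ (Fin (m + 1))} (hx : x ∈ P) :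
    u x * (1 - gauge P x) ^ m ≤ K * ((m + 1) / (2 * r)) ^ m := by
  have hd : 0 < 1 - gauge P x := by linarith [(mem_iff_gauge_lt_one hc ho h0).1 hx]
  rcases le_or_gt (u x) 0 with hux | hux
  · exact (mul_nonpos_of_nonpos_of_nonneg hux (by positivity)).trans (by positivity)
  have hS : IsOpen {y ∈ P | u y < u x} := by
    have := (ConvexOn.continuousOn ho hu).isOpen_inter_preimage ho (isOpen_Iio (a := u x))
    exact this
  obtain ⟨f, hf⟩ := geometric_hahn_banach_open_point (hu.convex_lt (u x)) hS
    (fun h => lt_irrefl _ h.2 : x ∉ {y ∈ P | u y < u x})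
  set e := (InnerProductSpace.toDual ℝ _).symm f with he
  have hfe : ∀ y, f y = ⟪e, y⟫ := fun y => by rw [he, InnerProductSpace.toDual_symm_apply]
  have he0 : e ≠ 0 := by
    intro h
    have := hf 0 ⟨h0, by rwa [hu0]⟩
    simp [hfe, h] at this
  have hxball : ball x (r * (1 - gauge P x)) ⊆ P := by
    intro y hy
    rw [mem_iff_gauge_lt_one hc ho h0]
    have h1 := gauge_add_le_gauge_add_norm_div hc hr hball x (y - x)
    rw [add_sub_cancel] at h1
    rw [mem_ball, dist_eq_norm, mul_comm, ← div_lt_iff₀ hr] at hy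
    linarith
  set A := frontier P ∩ {z | ⟪e, x⟫ < ⟪e, z⟫} with hA
  have hAm : MeasurableSet A := isClosed_frontier.measurableSet.inter
    (measurableSet_lt measurable_const (by fun_prop))
  have hrad : ∀ z ∈ A, ENNReal.ofReal (u x) ≤ radExt u z := by
    rintro z ⟨hz, hez⟩
    refine le_limsup_of_frequently_le' (Eventually.frequently ?_)
    have hcont : ContinuousAt (fun t : ℝ => ⟪e, t • z⟫) 1 := by fun_prop
    have h1 : ∀ᶠ t in 𝓝[<] (1 : ℝ), ⟪e, x⟫ < ⟪e, t • z⟫ :=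
      nhdsWithin_le_nhds (hcont.eventually (lt_mem_nhds (by simpa using hez)))
    have h2 : ∀ᶠ t in 𝓝[<] (1 : ℝ), 0 < t :=
      nhdsWithin_le_nhds (lt_mem_nhds one_pos)
    filter_upwards [h1, h2, self_mem_nhdsWithin] with t ht ht0 ht1
    refine ENNReal.ofReal_le_ofReal (not_lt.1 fun hlt => ?_)
    have := hf _ ⟨smul_mem_of_mem_frontier hc ho h0 hz ht0.le ht1, hlt⟩
    rw [hfe, hfe] at this
    exact this.not_gt ht
  have hcap := le_hausdorffMeasure_frontier_inter hc ho h0 hb he0 (by positivity) hxball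
  have key : ENNReal.ofReal (u x) * ENNReal.ofReal ((2 * (r * (1 - gauge P x) / (m + 1))) ^ m)
      ≤ ENNReal.ofReal K :=
    calc _ ≤ ENNReal.ofReal (u x) * μH[(m : ℝ)] A := by gcongr
      _ = ∫⁻ _ in A, ENNReal.ofReal (u x) ∂μH[(m : ℝ)] := by simp
      _ ≤ ∫⁻ z in A, radExt u z ∂μH[(m : ℝ)] := setLIntegral_mono' hAm hrad
      _ ≤ ∫⁻ z in frontier P, radExt u z ∂μH[(m : ℝ)] := lintegral_mono_set inter_subset_left
      _ ≤ _ := hint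
  rw [← ENNReal.ofReal_mul hux.le, ENNReal.ofReal_le_ofReal_iff hK] at key
  have hsplit : (2 * (r * (1 - gauge P x) / (m + 1))) ^ m * ((m + 1) / (2 * r)) ^ m
      = (1 - gauge P x) ^ m := by
    rw [← mul_pow]; congr 1; field_simp
  calc u x * (1 - gauge P x) ^ m
      = u x * (2 * (r * (1 - gauge P x) / (m + 1))) ^ m * ((m + 1) / (2 * r)) ^ m := by
        rw [mul_assoc, hsplit]
    _ ≤ _ := by gcongr

end BoundaryEstimate

section SecondDifference

variable {E : Type*} [NormedAddCommGroup E] [NormedSpace ℝ E] {P : Set E}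

/-- The weight `((1 - gauge P - 2η)₊) ^ (m + 2)`, a power of the truncated gauge distance to the
boundary of `P`. -/
def bdryWeight (P : Set E) (m : ℕ) (η : ℝ) (x : E) : ℝ :=
  max (1 - gauge P x - 2 * η) 0 ^ (m + 2)

theorem bdryWeight_nonneg (m : ℕ) (η : ℝ) (x : E) : 0 ≤ bdryWeight P m η x := by
  unfold bdryWeight; positivity

theorem bdryWeight_le_one (m : ℕ) {η : ℝ} (hη : 0 ≤ η) (x : E) : bdryWeight P m η x ≤ 1 :=
  pow_le_one₀ (le_max_right _ _)
    (max_le (by linarith [gauge_nonneg (s := P) x]) zero_le_one)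

theorem lt_of_bdryWeight_ne_zero {m : ℕ} {η : ℝ} {x : E} (h : bdryWeight P m η x ≠ 0) :
    2 * η < 1 - gauge P x := by
  by_contra hle
  exact h (by rw [bdryWeight, max_eq_right (by linarith), zero_pow (by omega)])

theorem continuous_bdryWeight (hc : Convex ℝ P) (h0 : P ∈ 𝓝 (0 : E)) (m : ℕ) (η : ℝ) :
    Continuous (bdryWeight P m η) := by
  have := continuous_gauge hc h0
  unfold bdryWeight
  fun_prop

theorem bdryWeight_second_difference_le (hc : Convex ℝ P) {r : ℝ} (hr : 0 < r)
    (hball : ball (0 : E) r ⊆ P) (m : ℕ) {w y : E} (hy : ‖w‖ / r < 1 - gauge P y) :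
    bdryWeight P m (‖w‖ / r) (y + w) + bdryWeight P m (‖w‖ / r) (y - w)
        - 2 * bdryWeight P m (‖w‖ / r) y
      ≤ 2 * (m + 2) ^ 2 * (1 - gauge P y) ^ m * (‖w‖ / r) ^ 2 := by
  have hη : 0 ≤ ‖w‖ / r := by positivity
  have h1 := abs_gauge_add_sub_gauge_le hc hr hball y w
  have h2 := abs_gauge_add_sub_gauge_le hc hr hball y (-w)
  rw [norm_neg, ← sub_eq_add_neg] at h2
  have h3 := two_mul_gauge_le hc (mem_of_superset (ball_mem_nhds 0 hr) hball) y w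
  refine posPart_pow_second_difference_le m ?_ ?_ ?_ ?_ ?_
  · rw [abs_sub_comm] at h1; convert h1 using 2; ring
  · rw [abs_sub_comm] at h2; convert h2 using 2; ring
  all_goals linarith

variable [MeasurableSpace E] [BorelSpace E] [FiniteDimensional ℝ E]

/-- Weighted second difference quotients of a convex function of polynomial growth are bounded
in `L¹`, uniformly in the step. -/
theorem lintegral_bdryWeight_mul_second_difference_le (μ : Measure E) [μ.IsAddHaarMeasure]
    (hc : Convex ℝ P) (ho : IsOpen P)
    (hb : Bornology.IsBounded P) {r : ℝ} (hr : 0 < r) (hball : ball (0 : E) r ⊆ P) {u : E → ℝ}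
    (hu : ConvexOn ℝ P u) (hu0 : ∀ x ∈ P, 0 ≤ u x) {m : ℕ} {C : ℝ} (hC : 0 ≤ C)
    (hgrowth : ∀ x ∈ P, u x * (1 - gauge P x) ^ m ≤ C) {w : E} (hw : 0 < ‖w‖) :
    AEMeasurable (fun x => bdryWeight P m (‖w‖ / r) x * (u (x + w) + u (x - w) - 2 * u x)) μ ∧
    ∫⁻ x, ENNReal.ofReal
        (bdryWeight P m (‖w‖ / r) x * (u (x + w) + u (x - w) - 2 * u x)) ∂μ
      ≤ ENNReal.ofReal (2 * (m + 2) ^ 2 * C * (‖w‖ / r) ^ 2 * μ.real P) := by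
  have h0 : (0 : E) ∈ P := hball (mem_ball_self hr)
  have hn := ho.mem_nhds h0
  have hmem : ∀ {x}, x ∈ P ↔ gauge P x < 1 := fun {x} => mem_iff_gauge_lt_one hc ho h0
  set η := ‖w‖ / r with hη
  have hη0 : 0 < η := by positivity
  set ψ := bdryWeight P m η with hψ
  have hψc : Continuous ψ := continuous_bdryWeight hc hn m η
  have hψb : ∀ x, ‖ψ x‖ ≤ 1 := fun x => by
    rw [Real.norm_of_nonneg (bdryWeight_nonneg _ _ _)]; exact bdryWeight_le_one m hη0.le x
  set D : Set E := {x | η < 1 - gauge P x} with hD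
  have hDP : D ⊆ P := fun x hx => hmem.2 (by simp only [hD, mem_ofPred_eq] at hx; linarith)
  have hDm : MeasurableSet D :=
    (isOpen_lt continuous_const (continuous_const.sub (continuous_gauge hc hn))).measurableSet
  set v : E → ℝ := D.indicator u with hv
  have hvint : Integrable v μ := by
    refine IntegrableOn.integrable_indicator ?_ hDm
    refine IntegrableOn.of_bound ((measure_mono hDP).trans_lt hb.measure_lt_top)
      (((ConvexOn.continuousOn ho hu).mono hDP).aestronglyMeasurable hDm) (C / η ^ m) ?_
    filter_upwards [ae_restrict_mem hDm] with x hx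
    have hxP := hDP hx
    simp only [hD, mem_ofPred_eq] at hx
    rw [Real.norm_of_nonneg (hu0 x hxP), le_div_iff₀ (by positivity)]
    refine le_trans ?_ (hgrowth x hxP)
    have := hu0 x hxP
    gcongr
  have hvP : Integrable (fun x => v (x + w)) μ := hvint.comp_add_right w
  have hvM : Integrable (fun x => v (x - w)) μ := hvint.comp_sub_right w
  have hψae : AEStronglyMeasurable ψ μ := hψc.aestronglyMeasurable
  have I1 := hvP.bdd_mul (c := 1) hψae (ae_of_all _ hψb)
  have I2 := hvM.bdd_mul (c := 1) hψae (ae_of_all _ hψb)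
  have I3 := hvint.bdd_mul (c := 1) hψae (ae_of_all _ hψb)
  have hmemD : ∀ x, 2 * η < 1 - gauge P x → x ∈ D ∧ x + w ∈ D ∧ x - w ∈ D := by
    intro x hx
    have h1 := gauge_add_le_gauge_add_norm_div hc hr hball x w
    have h2 := gauge_add_le_gauge_add_norm_div hc hr hball x (-w)
    rw [norm_neg, ← sub_eq_add_neg] at h2
    rw [← hη] at h1 h2
    refine ⟨?_, ?_, ?_⟩ <;> simp only [hD, mem_ofPred_eq] <;> linarith
  have heq : (fun x => ψ x * (u (x + w) + u (x - w) - 2 * u x))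
      = fun x => ψ x * v (x + w) + ψ x * v (x - w) - 2 * (ψ x * v x) := by
    funext x
    by_cases hx : ψ x = 0
    · simp [hx]
    · obtain ⟨h1, h2, h3⟩ := hmemD x (lt_of_bdryWeight_ne_zero hx)
      rw [hv, indicator_of_mem h1, indicator_of_mem h2, indicator_of_mem h3]
      ring
  have hI : Integrable (fun x => ψ x * (u (x + w) + u (x - w) - 2 * u x)) μ := by
    rw [heq]; exact (I1.add I2).sub (I3.const_mul 2)
  refine ⟨hI.aemeasurable, ?_⟩
  have hpos : ∀ x, 0 ≤ ψ x * (u (x + w) + u (x - w) - 2 * u x) := by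
    intro x
    by_cases hx : ψ x = 0
    · simp [hx]
    · obtain ⟨-, h2, h3⟩ := hmemD x (lt_of_bdryWeight_ne_zero hx)
      refine mul_nonneg (bdryWeight_nonneg _ _ _) ?_
      have := hu.2 (hDP h2) (hDP h3) (by norm_num : (0 : ℝ) ≤ 1 / 2)
        (by norm_num : (0 : ℝ) ≤ 1 / 2) (by norm_num)
      rw [← smul_add, show x + w + (x - w) = (2 : ℝ) • x by rw [two_smul]; abel, smul_smul] at this
      norm_num at this
      linarith
  rw [← ofReal_integral_eq_lintegral_ofReal hI (ae_of_all _ hpos)]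
  refine ENNReal.ofReal_le_ofReal ?_
  have T1 : ∫ x, ψ x * v (x + w) ∂μ = ∫ x, ψ (x - w) * v x ∂μ := by
    simpa using integral_add_right_eq_self (μ := μ) (fun x => ψ (x - w) * v x) w
  have T2 : ∫ x, ψ x * v (x - w) ∂μ = ∫ x, ψ (x + w) * v x ∂μ := by
    simpa using integral_sub_right_eq_self (μ := μ) (fun x => ψ (x + w) * v x) w
  have J1 : Integrable (fun x => ψ (x - w) * v x) μ :=
    hvint.bdd_mul (c := 1) (hψc.comp (by fun_prop)).aestronglyMeasurable
      (ae_of_all _ fun x => hψb _)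
  have J2 : Integrable (fun x => ψ (x + w) * v x) μ :=
    hvint.bdd_mul (c := 1) (hψc.comp (by fun_prop)).aestronglyMeasurable
      (ae_of_all _ fun x => hψb _)
  have hbound : ∀ y, ψ (y - w) * v y + ψ (y + w) * v y - 2 * (ψ y * v y)
      ≤ P.indicator (fun _ => 2 * (m + 2) ^ 2 * C * η ^ 2) y := by
    intro y
    by_cases hy : y ∈ D
    · rw [indicator_of_mem (hDP hy), hv, indicator_of_mem hy]
      have h1 := mul_le_mul_of_nonneg_left
        (bdryWeight_second_difference_le hc hr hball m (w := w) hy) (hu0 y (hDP hy))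
      rw [← hη, ← hψ] at h1
      have h2 := mul_le_mul_of_nonneg_left (hgrowth y (hDP hy))
        (by positivity : (0 : ℝ) ≤ 2 * (m + 2) ^ 2 * η ^ 2)
      linarith
    · rw [hv, indicator_of_notMem hy]
      simp only [mul_zero, add_zero, sub_zero]
      exact indicator_nonneg (fun _ _ => by positivity) y
  calc ∫ x, ψ x * (u (x + w) + u (x - w) - 2 * u x) ∂μ
      = ∫ x, ψ (x - w) * v x + ψ (x + w) * v x - 2 * (ψ x * v x) ∂μ := by
        rw [heq, integral_sub (by exact I1.add I2) (I3.const_mul 2), integral_add I1 I2,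
          integral_sub (by exact J1.add J2) (I3.const_mul 2), integral_add J1 J2, T1, T2]
    _ ≤ ∫ x, P.indicator (fun _ => 2 * (m + 2) ^ 2 * C * η ^ 2) x ∂μ :=
        integral_mono ((J1.add J2).sub (I3.const_mul 2))
          ((integrable_indicator_iff ho.measurableSet).2
            (integrableOn_const hb.measure_lt_top.ne)) hbound
    _ = 2 * (m + 2) ^ 2 * C * η ^ 2 * μ.real P := by
        rw [integral_indicator ho.measurableSet, setIntegral_const, smul_eq_mul, mul_comm]

end SecondDifference

section AlexandrovHessian

variable {n : ℕ}

theorem tendsto_second_difference_div_sq {u : EuclideanSpace ℝ (Fin n) → ℝ}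
    {A : Matrix (Fin n) (Fin n) ℝ} {x g : EuclideanSpace ℝ (Fin n)}
    (h : Tendsto (fun y : EuclideanSpace ℝ (Fin n) =>
          (u y - u x - ⟪g, y - x⟫
            - (1 / 2) * ∑ i : Fin n, ∑ j : Fin n, A i j * (y - x) i * (y - x) j)
          / ‖y - x‖ ^ 2) (𝓝[≠] x) (𝓝 0)) (k : Fin n) :
    Tendsto (fun t : ℝ => (u (x + t • EuclideanSpace.single k (1 : ℝ))
        + u (x - t • EuclideanSpace.single k (1 : ℝ)) - 2 * u x) / t ^ 2)
      (𝓝[≠] 0) (𝓝 (A k k)) := by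
  set e : EuclideanSpace ℝ (Fin n) := EuclideanSpace.single k (1 : ℝ) with he
  have hen : ‖e‖ = 1 := by simp [he]
  have he0 : e ≠ 0 := norm_ne_zero_iff.1 (by rw [hen]; exact one_ne_zero)
  have hquad : ∀ t : ℝ, ∑ i : Fin n, ∑ j : Fin n, A i j * (t • e) i * (t • e) j
      = A k k * t ^ 2 := by
    intro t
    have hei : ∀ i, (t • e) i = if i = k then t else 0 := fun i => by
      simp [he, PiLp.single_apply]
    simp only [hei, mul_ite, mul_zero, Finset.sum_ite_eq', Finset.mem_univ, if_true, ite_mul,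
      zero_mul]
    ring
  have key : ∀ s : ℝ, s ≠ 0 → Tendsto (fun t : ℝ => x + (s * t) • e) (𝓝[≠] 0) (𝓝[≠] x) := by
    intro s hs
    refine tendsto_nhdsWithin_iff.2 ⟨?_, ?_⟩
    · have : Continuous fun t : ℝ => x + (s * t) • e := by fun_prop
      simpa using (this.tendsto 0).mono_left nhdsWithin_le_nhds
    · filter_upwards [self_mem_nhdsWithin] with t ht
      simpa [he0, hs] using ht
  have hsum := ((h.comp (key 1 one_ne_zero)).add (h.comp (key (-1) (by norm_num)))).add_const
    (A k k)
  rw [add_zero, zero_add] at hsum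
  refine hsum.congr' ?_
  filter_upwards [self_mem_nhdsWithin] with t ht
  have ht' : t ≠ 0 := ht
  simp only [Function.comp_apply, add_sub_cancel_left, hquad, inner_smul_right, norm_smul, hen,
    mul_one, Real.norm_eq_abs, sq_abs, one_mul, neg_mul, neg_smul, ← sub_eq_add_neg]
  have h2 : -(t • e) = (-t) • e := (neg_smul t e).symm
  rw [show x - t • e - x = (-t) • e by rw [neg_smul]; abel, hquad, inner_smul_right, norm_smul, hen,
    mul_one, Real.norm_eq_abs, sq_abs]
  field_simp
  ring

theorem lintegral_gauge_pow_mul_hessian_diag_lt_top {P : Set (EuclideanSpace ℝ (Fin n))}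
    (hc : Convex ℝ P) (ho : IsOpen P) (hb : Bornology.IsBounded P) {r : ℝ} (hr : 0 < r)
    (hball : ball (0 : EuclideanSpace ℝ (Fin n)) r ⊆ P) {u : EuclideanSpace ℝ (Fin n) → ℝ}
    (hu : ConvexOn ℝ P u) (hu0 : ∀ x ∈ P, 0 ≤ u x) {m : ℕ} {C : ℝ} (hC : 0 ≤ C)
    (hgrowth : ∀ x ∈ P, u x * (1 - gauge P x) ^ m ≤ C)
    {H : EuclideanSpace ℝ (Fin n) → Matrix (Fin n) (Fin n) ℝ} (hH : IsAlexHessian P u H)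
    (k : Fin n) :
    ∫⁻ x in P, ENNReal.ofReal ((1 - gauge P x) ^ (m + 2) * H x k k) < ⊤ := by
  have h0 := hball (mem_ball_self hr)
  set e : EuclideanSpace ℝ (Fin n) := EuclideanSpace.single k (1 : ℝ) with he
  have hen : ‖e‖ = 1 := by simp [he]
  let s : ℕ → ℝ := fun j => 1 / ((j : ℝ) + 1)
  have hs : ∀ j, 0 < s j := fun j => by positivity
  have hs0 : Tendsto s atTop (𝓝 0) := tendsto_one_div_add_atTop_nhds_zero_nat
  have hsn : ∀ j, ‖s j • e‖ = s j := fun j => by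
    rw [norm_smul, hen, mul_one, Real.norm_of_nonneg (hs j).le]
  have hs' : Tendsto s atTop (𝓝[≠] 0) :=
    tendsto_nhdsWithin_iff.2 ⟨hs0, .of_forall fun j => (hs j).ne'⟩
  let F : ℕ → EuclideanSpace ℝ (Fin n) → ℝ := fun j x =>
    bdryWeight P m (s j / r) x * (u (x + s j • e) + u (x - s j • e) - 2 * u x)
  have hF : ∀ j, AEMeasurable (F j) volume ∧ ∫⁻ x, ENNReal.ofReal (F j x)
      ≤ ENNReal.ofReal (2 * (m + 2) ^ 2 * C * (s j / r) ^ 2 * volume.real P) := fun j => by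
    have := lintegral_bdryWeight_mul_second_difference_le (w := s j • e) volume hc ho hb hr hball
      hu hu0 hC hgrowth (by rw [hsn]; exact hs j)
    rwa [hsn] at this
  set M := ENNReal.ofReal (2 * (m + 2) ^ 2 * C / r ^ 2 * volume.real P) with hM
  have hle : ∀ j, ∫⁻ x in P, ENNReal.ofReal (F j x / s j ^ 2) ≤ M := fun j => by
    refine (setLIntegral_le_lintegral _ _).trans ?_
    have hsj := hs j
    simp_rw [div_eq_inv_mul, ENNReal.ofReal_mul (inv_nonneg.2 (sq_nonneg (s j)))]
    rw [lintegral_const_mul'' _ (hF j).1.ennreal_ofReal]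
    refine (mul_le_mul_right (hF j).2 _).trans_eq ?_
    rw [← ENNReal.ofReal_mul (by positivity), hM]
    congr 1
    field_simp
  have hlim : ∀ᵐ x ∂volume.restrict P,
      Tendsto (fun j => ENNReal.ofReal (F j x / s j ^ 2)) atTop
        (𝓝 (ENNReal.ofReal ((1 - gauge P x) ^ (m + 2) * H x k k))) := by
    filter_upwards [hH.2, ae_restrict_mem ho.measurableSet] with x hx hxP
    obtain ⟨-, g, hg⟩ := hx
    have h1 := (tendsto_second_difference_div_sq hg k).comp hs'
    have h2 : Tendsto (fun j => bdryWeight P m (s j / r) x) atTop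
        (𝓝 ((1 - gauge P x) ^ (m + 2))) := by
      have hcont : Continuous fun t : ℝ => bdryWeight P m (t / r) x := by
        unfold bdryWeight; fun_prop
      have := (hcont.tendsto 0).comp hs0
      have hpos : 0 ≤ 1 - gauge P x := by linarith [(mem_iff_gauge_lt_one hc ho h0).1 hxP]
      simpa [bdryWeight, max_eq_left hpos, Function.comp_def] using this
    refine ENNReal.tendsto_ofReal ((h2.mul h1).congr fun j => ?_)
    simp only [F, Function.comp_apply, he]
    ring
  calc ∫⁻ x in P, ENNReal.ofReal ((1 - gauge P x) ^ (m + 2) * H x k k)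
      = ∫⁻ x in P, liminf (fun j => ENNReal.ofReal (F j x / s j ^ 2)) atTop :=
        lintegral_congr_ae (hlim.mono fun x hx => hx.liminf_eq.symm)
    _ ≤ liminf (fun j => ∫⁻ x in P, ENNReal.ofReal (F j x / s j ^ 2)) atTop :=
        lintegral_liminf_le' fun j => ((hF j).1.restrict.div_const _).ennreal_ofReal
    _ ≤ M := liminf_le_of_le (by isBoundedDefault) fun b hb => by
        obtain ⟨j, hj⟩ := hb.exists
        exact hj.trans (hle j)
    _ < ⊤ := ENNReal.ofReal_lt_top

theorem det_le_trace_pow {A : Matrix (Fin n) (Fin n) ℝ} (hA : A.PosSemidef) :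
    A.det ≤ A.trace ^ n := by
  have ht : A.trace = ∑ i, hA.1.eigenvalues i := by
    simpa using hA.1.trace_eq_sum_eigenvalues
  have hd : A.det = ∏ i, hA.1.eigenvalues i := by
    simpa using hA.1.det_eq_prod_eigenvalues
  rw [ht, hd]
  calc ∏ i, hA.1.eigenvalues i ≤ ∏ _i : Fin n, ∑ i, hA.1.eigenvalues i :=
        Finset.prod_le_prod (fun i _ => hA.eigenvalues_nonneg i) fun i _ =>
          Finset.single_le_sum (fun j _ => hA.eigenvalues_nonneg j) (Finset.mem_univ i)
    _ = _ := by simp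

theorem log_det_le {A : Matrix (Fin n) (Fin n) ℝ} (hA : A.PosSemidef) {δ : ℝ} (hδ : 0 < δ)
    (hδ1 : δ ≤ 1) (a : ℕ) :
    Real.log A.det ≤ n * (∑ k, δ ^ a * A k k + a * -Real.log δ) := by
  have hlogδ : 0 ≤ -Real.log δ := by linarith [Real.log_nonpos hδ.le hδ1]
  have htr : ∑ k, δ ^ a * A k k = δ ^ a * A.trace := by
    rw [Matrix.trace, Finset.mul_sum]; rfl
  have htr0 : 0 ≤ A.trace := hA.trace_nonneg
  rw [htr]
  have hrhs : 0 ≤ n * (δ ^ a * A.trace + a * -Real.log δ) := by positivity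
  rcases le_or_gt A.det 1 with h | h
  · exact (Real.log_nonpos hA.det_nonneg h).trans hrhs
  rcases Nat.eq_zero_or_pos n with hn | hn
  · subst hn
    simp at h
  have htpos : 0 < A.trace := by
    refine htr0.lt_of_ne fun h' => ?_
    have := det_le_trace_pow hA
    rw [← h', zero_pow hn.ne'] at this
    linarith
  have h1 : Real.log A.det ≤ n * Real.log A.trace := by
    rw [← Real.log_pow]
    exact Real.log_le_log (by linarith) (det_le_trace_pow hA)
  have h2 : Real.log (δ ^ a * A.trace) = a * Real.log δ + Real.log A.trace := by
    rw [Real.log_mul (by positivity) htpos.ne', Real.log_pow]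
  have h3 : Real.log (δ ^ a * A.trace) ≤ δ ^ a * A.trace :=
    (Real.log_le_sub_one_of_pos (by positivity)).trans (by linarith)
  refine h1.trans ?_
  gcongr
  linarith

/-- Integrability of `log⁺ det` of the Alexandrov Hessian of a convex function of polynomial
growth at the boundary. -/
theorem lintegral_log_det_lt_top_of_growth {P : Set (EuclideanSpace ℝ (Fin n))}
    (hc : Convex ℝ P) (ho : IsOpen P) (hb : Bornology.IsBounded P) {r : ℝ} (hr : 0 < r)
    (hball : ball (0 : EuclideanSpace ℝ (Fin n)) r ⊆ P) {u : EuclideanSpace ℝ (Fin n) → ℝ}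
    (hu : ConvexOn ℝ P u) (hu0 : ∀ x ∈ P, 0 ≤ u x) {m : ℕ} {C : ℝ} (hC : 0 ≤ C)
    (hgrowth : ∀ x ∈ P, u x * (1 - gauge P x) ^ m ≤ C)
    {H : EuclideanSpace ℝ (Fin n) → Matrix (Fin n) (Fin n) ℝ} (hH : IsAlexHessian P u H) :
    ∫⁻ x in P, ENNReal.ofReal (Real.log (H x).det) < ⊤ := by
  have h0 := hball (mem_ball_self hr)
  have hgm : Measurable (gauge P) := (continuous_gauge hc (ho.mem_nhds h0)).measurable
  have hdiag := lintegral_gauge_pow_mul_hessian_diag_lt_top hc ho hb hr hball hu hu0 hC hgrowth hH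
  have hlog := lintegral_neg_log_one_sub_gauge_lt_top (volume : Measure (EuclideanSpace ℝ (Fin n)))
    hc ho h0 hb
  have hdm : ∀ k, Measurable fun x =>
      ENNReal.ofReal ((1 - gauge P x) ^ (m + 2) * H x k k) := fun k =>
    (((measurable_const.sub hgm).pow_const _).mul (hH.1 k k)).ennreal_ofReal
  calc ∫⁻ x in P, ENNReal.ofReal (Real.log (H x).det)
      ≤ ∫⁻ x in P, ENNReal.ofReal n *
          ((∑ k, ENNReal.ofReal ((1 - gauge P x) ^ (m + 2) * H x k k))
            + ENNReal.ofReal (m + 2 : ℕ) * ENNReal.ofReal (-Real.log (1 - gauge P x))) := by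
        refine lintegral_mono_ae ?_
        filter_upwards [hH.2, ae_restrict_mem ho.measurableSet] with x hx hxP
        have hδ : 0 < 1 - gauge P x := by linarith [(mem_iff_gauge_lt_one hc ho h0).1 hxP]
        have hδ1 : 1 - gauge P x ≤ 1 := by linarith [gauge_nonneg (s := P) x]
        have hlogδ : 0 ≤ -Real.log (1 - gauge P x) := by linarith [Real.log_nonpos hδ.le hδ1]
        have hk : ∀ k ∈ Finset.univ, 0 ≤ (1 - gauge P x) ^ (m + 2) * H x k k := fun k _ =>
          mul_nonneg (by positivity) hx.1.diag_nonneg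
        rw [← ENNReal.ofReal_sum_of_nonneg hk, ← ENNReal.ofReal_mul (Nat.cast_nonneg _),
          ← ENNReal.ofReal_add (Finset.sum_nonneg hk) (by positivity),
          ← ENNReal.ofReal_mul (Nat.cast_nonneg _)]
        exact ENNReal.ofReal_le_ofReal (log_det_le hx.1 hδ hδ1 (m + 2))
    _ = ENNReal.ofReal n *
          ((∑ k, ∫⁻ x in P, ENNReal.ofReal ((1 - gauge P x) ^ (m + 2) * H x k k))
            + ENNReal.ofReal (m + 2 : ℕ) *
              ∫⁻ x in P, ENNReal.ofReal (-Real.log (1 - gauge P x))) := by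
        rw [lintegral_const_mul' _ _ ENNReal.ofReal_ne_top,
          lintegral_add_left (Finset.measurable_fun_sum _ fun k _ => hdm k),
          lintegral_finsetSum _ fun k _ => hdm k,
          lintegral_const_mul' _ _ ENNReal.ofReal_ne_top]
    _ < ⊤ := ENNReal.mul_lt_top ENNReal.ofReal_lt_top
        (ENNReal.add_lt_top.2 ⟨ENNReal.sum_lt_top.2 fun k _ => hdiag k,
          ENNReal.mul_lt_top ENNReal.ofReal_lt_top hlog⟩)

end AlexandrovHessian

theorem isOpen_poly {n : ℕ} {ι : Type*} [Fintype ι] (l : ι → EuclideanSpace ℝ (Fin n))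
    (lam : ι → ℝ) : IsOpen (Poly l lam) := by
  have : Poly l lam = ⋂ i, {x | ⟪l i, x⟫ < lam i} := by ext; simp [Poly]
  rw [this]
  exact isOpen_iInter_of_finite fun i => isOpen_lt (by fun_prop) continuous_const

theorem convex_poly {n : ℕ} {ι : Type*} [Fintype ι] (l : ι → EuclideanSpace ℝ (Fin n))
    (lam : ι → ℝ) : Convex ℝ (Poly l lam) := by
  have : Poly l lam = ⋂ i, {x | ⟪l i, x⟫ < lam i} := by ext; simp [Poly]
  rw [this]
  exact convex_iInter fun i => convex_halfSpace_lt (innerₗ _ (l i)).isLinear (lam i)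

/-- Proposition 2.1: for a bounded Delzant polytope `P` containing the
origin and any `u ∈ 𝒞⋆^K(P)` with Alexandrov Hessian `H`, the positive part
`log⁺ (det H)` is integrable on `P`. -/
theorem logPlus_det_integrable
    (n d : ℕ) (hn : 1 ≤ n) (l : Fin d → EuclideanSpace ℝ (Fin n)) (lam : Fin d → ℝ)
    (hl : ∀ i, l i ≠ 0) (hlam : ∀ i, 0 < lam i)
    (hbd : Bornology.IsBounded (Poly l lam)) (hDel : IsDelzant l lam)
    (K : ℝ) (hK : 0 < K) (u : EuclideanSpace ℝ (Fin n) → ℝ)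
    (H : EuclideanSpace ℝ (Fin n) → Matrix (Fin n) (Fin n) ℝ)
    (hu : MemCstar l lam K u) (hH : IsAlexHessian (Poly l lam) u H) :
    ∫⁻ x in Poly l lam, ENNReal.ofReal (Real.log (H x).det) < ⊤ := by
  obtain ⟨m, rfl⟩ : ∃ m, n = m + 1 := ⟨n - 1, by omega⟩
  obtain ⟨huc, hu0, hunn, -, hint⟩ := hu
  have ho := isOpen_poly l lam
  have hc := convex_poly l lam
  have h0 : (0 : EuclideanSpace ℝ (Fin (m + 1))) ∈ Poly l lam := fun i => by simpa using hlam i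
  obtain ⟨r, hr, hball⟩ := Metric.mem_nhds_iff.1 (ho.mem_nhds h0)
  have hint' : ∫⁻ z in frontier (Poly l lam), radExt u z ∂μH[(m : ℝ)] ≤ ENNReal.ofReal K := by
    have hm : ((m + 1 : ℕ) : ℝ) - 1 = m := by push_cast; ring
    rwa [sigma0, hm] at hint
  exact lintegral_log_det_lt_top_of_growth hc ho hbd hr hball huc hunn (m := m)
    (by positivity : 0 ≤ K * ((m + 1) / (2 * r)) ^ m)
    (fun x hx => mul_one_sub_gauge_pow_le hc ho h0 hbd hr hball huc hu0 hK.le hint' hx) hH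

end ToricExtremal
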